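/- Let L = B Bᵀ be a real psd n×n matrix and L̂ = B P Bᵀ with P a real symmetric idempotent matrix. Let ŝ = tr( L − L̂ + L̂(I + L̂)⁻¹ ) and s̃ = tr( L̂(I + L̂)⁻¹ ). Suppose tr( L(I + L)⁻¹ L − L̂ (I + L)⁻¹ L̂ ) ≤ 1 and q ≥ max{ŝ², ŝ}. Then e^{ q − q e^{ŝ/q} + s̃ } · det(I + L) / det(I + L̂) ≥ e^{−2}. In particular, each iteration of the rejection sampling loop of DPP-VFX accepts with probability at least e^{−2}. -/

import Mathlib

open Matrix

namespace Matrix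

variable {m n : Type*} [Fintype m] [Fintype n]

theorem posSemidef_self_mul_transpose (B : Matrix m n ℝ) : (B * Bᵀ).PosSemidef := by
  simpa [conjTranspose_eq_transpose_of_trivial] using posSemidef_self_mul_conjTranspose B

variable [DecidableEq m]

theorem PosSemidef.exists_eq_transpose_mul_self {A : Matrix m m ℝ} (hA : A.PosSemidef) :
    ∃ R : Matrix m m ℝ, A = Rᵀ * R := by
  open scoped MatrixOrder in
  obtain ⟨R, hR⟩ := CStarAlgebra.nonneg_iff_eq_star_mul_self.mp hA.nonneg
  exact ⟨R, by rw [hR, star_eq_conjTranspose, conjTranspose_eq_transpose_of_trivial]⟩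

theorem posDef_one_add_self_mul_transpose (B : Matrix m n ℝ) : (1 + B * Bᵀ).PosDef :=
  PosDef.one.add_posSemidef (posSemidef_self_mul_transpose B)

theorem PosSemidef.trace_mul_mul_mul_transpose_nonneg [DecidableEq n]
    {A : Matrix m m ℝ} {D : Matrix n n ℝ}
    (hA : A.PosSemidef) (hD : D.PosSemidef) (C : Matrix m n ℝ) :
    0 ≤ (A * C * D * Cᵀ).trace := by
  obtain ⟨R, rfl⟩ := hA.exists_eq_transpose_mul_self
  obtain ⟨S, rfl⟩ := hD.exists_eq_transpose_mul_self
  have h : (Rᵀ * R * C * (Sᵀ * S) * Cᵀ).trace = ((R * C * Sᵀ) * (R * C * Sᵀ)ᵀ).trace := by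
    simp only [transpose_mul, transpose_transpose, Matrix.mul_assoc]
    rw [trace_mul_comm]
    simp only [Matrix.mul_assoc]
  rw [h]
  exact (posSemidef_self_mul_transpose _).trace_nonneg

/-- The determinant of a positive semidefinite matrix `Y` is at most `exp (tr (Y - 1))`. -/
theorem PosSemidef.det_le_exp_trace_sub_card {Y : Matrix m m ℝ} (hY : Y.PosSemidef) :
    Y.det ≤ Real.exp (Y.trace - Fintype.card m) := by
  have ht : Y.trace - Fintype.card m = ∑ i, (hY.isHermitian.eigenvalues i - 1) := by
    rw [hY.isHermitian.trace_eq_sum_eigenvalues]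
    simp
  rw [ht, Real.exp_sum, hY.isHermitian.det_eq_prod_eigenvalues]
  refine Finset.prod_le_prod (fun i _ => hY.eigenvalues_nonneg i) fun i _ => ?_
  simpa using Real.add_one_le_exp (hY.isHermitian.eigenvalues i - 1)

theorem PosDef.det_le_det_mul_exp_trace {A C : Matrix m m ℝ} (hA : A.PosDef)
    (hC : C.PosSemidef) :
    C.det ≤ A.det * Real.exp ((A⁻¹ * C).trace - Fintype.card m) := by
  obtain ⟨R, hR⟩ := hA.inv.posSemidef.exists_eq_transpose_mul_self
  have hY : (R * C * Rᵀ).PosSemidef := by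
    simpa [conjTranspose_eq_transpose_of_trivial] using hC.mul_mul_conjTranspose_same R
  have ht : (R * C * Rᵀ).trace = (A⁻¹ * C).trace := by
    rw [trace_mul_comm, ← Matrix.mul_assoc, hR]
  have hd : A.det * (R * C * Rᵀ).det = C.det := by
    have h1 : A.det * (A⁻¹).det = 1 := by
      rw [← det_mul, mul_nonsing_inv _ hA.det_pos.ne'.isUnit, det_one]
    rw [hR, det_mul, det_transpose] at h1
    rw [det_mul, det_mul, det_transpose]
    linear_combination C.det * h1
  have h := mul_le_mul_of_nonneg_left hY.det_le_exp_trace_sub_card hA.det_pos.le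
  rwa [hd, ht] at h

/-- For `A` positive definite and `P` an orthogonal projection, `tr P ≤ tr (A⁻¹ P A P)`. -/
theorem PosDef.trace_le_trace_inv_mul_mul_mul {A P : Matrix m m ℝ} (hA : A.PosDef)
    (hPsym : Pᵀ = P) (hPidem : P * P = P) :
    P.trace ≤ (A⁻¹ * P * A * P).trace := by
  have hAt : Aᵀ = A := by
    simpa [conjTranspose_eq_transpose_of_trivial] using hA.isHermitian.eq
  have hu : IsUnit A.det := hA.det_pos.ne'.isUnit
  have h := hA.inv.posSemidef.trace_mul_mul_mul_transpose_nonneg hA.inv.posSemidef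
    (P * A - A * P)
  have e : A⁻¹ * (P * A - A * P) * A⁻¹ * (P * A - A * P)ᵀ
      = A⁻¹ * P * A * P - P - A⁻¹ * P * A + P * (A⁻¹ * P * A) := by
    have e1 : A⁻¹ * (P * A - A * P) * A⁻¹ = A⁻¹ * P - P * A⁻¹ := by
      rw [Matrix.mul_sub, Matrix.sub_mul, ← Matrix.mul_assoc, mul_nonsing_inv_cancel_right _ _ hu,
        nonsing_inv_mul_cancel_left _ _ hu]
    have e2 : P * A⁻¹ * (A * P) = P := by
      rw [← Matrix.mul_assoc, nonsing_inv_mul_cancel_right _ _ hu, hPidem]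
    have e3 : A⁻¹ * P * (P * A) = A⁻¹ * P * A := by
      rw [← Matrix.mul_assoc, Matrix.mul_assoc _ P P, hPidem]
    rw [e1, transpose_sub, transpose_mul, transpose_mul, hAt, hPsym, Matrix.sub_mul,
      Matrix.mul_sub, Matrix.mul_sub, e2, e3]
    simp only [Matrix.mul_assoc]
    abel
  have t1 : (A⁻¹ * P * A).trace = P.trace := by
    rw [trace_mul_comm, mul_nonsing_inv_cancel_left _ _ hu]
  rw [e, trace_add, trace_sub, trace_sub, t1, trace_mul_comm P] at h
  linarith

variable [DecidableEq n]

theorem transpose_mul_inv_one_add_mul (B : Matrix m n ℝ) :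
    Bᵀ * (1 + B * Bᵀ)⁻¹ * B = 1 - (1 + Bᵀ * B)⁻¹ := by
  have hu : IsUnit (1 + B * Bᵀ).det := (posDef_one_add_self_mul_transpose B).det_pos.ne'.isUnit
  have hv : IsUnit (1 + Bᵀ * B).det := by
    simpa using (posDef_one_add_self_mul_transpose Bᵀ).det_pos.ne'.isUnit
  have hpush : (1 + B * Bᵀ)⁻¹ * B = B * (1 + Bᵀ * B)⁻¹ := by
    have h : B * (1 + Bᵀ * B) = (1 + B * Bᵀ) * B := by
      simp [Matrix.mul_add, Matrix.add_mul, Matrix.mul_assoc]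
    rw [← mul_nonsing_inv_cancel_right _ ((1 + B * Bᵀ)⁻¹ * B) hv, Matrix.mul_assoc _ B, h,
      nonsing_inv_mul_cancel_left _ _ hu]
  have h1 := mul_nonsing_inv _ hv
  rw [Matrix.add_mul, Matrix.one_mul] at h1
  rw [Matrix.mul_assoc, hpush, ← Matrix.mul_assoc]
  exact eq_sub_of_add_eq' h1

theorem trace_nystrom_residual_nonneg (B : Matrix m n ℝ) {P : Matrix n n ℝ}
    (hPsym : Pᵀ = P) (hPidem : P * P = P) :
    0 ≤ ((B * Bᵀ - B * P * Bᵀ) * (1 + B * Bᵀ)⁻¹ * (B * P * Bᵀ)).trace := by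
  have hA : (1 + Bᵀ * B).PosDef := by simpa using posDef_one_add_self_mul_transpose Bᵀ
  have hu : IsUnit (1 + Bᵀ * B).det := hA.det_pos.ne'.isUnit
  have hK := transpose_mul_inv_one_add_mul B
  have key := hA.trace_le_trace_inv_mul_mul_mul hPsym hPidem
  set A := 1 + Bᵀ * B with hAdef
  have hG : Bᵀ * B = A - 1 := by simp [hAdef]
  have e : ((B * Bᵀ - B * P * Bᵀ) * (1 + B * Bᵀ)⁻¹ * (B * P * Bᵀ)).trace
      = ((A - 1) * ((1 - P) * (1 - A⁻¹) * P)).trace := by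
    rw [← hK, ← hG, Matrix.mul_assoc Bᵀ B, trace_mul_comm Bᵀ]
    simp only [Matrix.mul_assoc, Matrix.mul_sub, Matrix.sub_mul, Matrix.one_mul]
  have e' : (1 - P) * (1 - A⁻¹) * P = P * A⁻¹ * P - A⁻¹ * P := by
    simp only [Matrix.mul_sub, Matrix.sub_mul, Matrix.one_mul, Matrix.mul_one, hPidem]
    abel
  have t1 : (P * A⁻¹ * P).trace = (A⁻¹ * P).trace := by
    rw [trace_mul_comm, ← Matrix.mul_assoc, hPidem, trace_mul_comm]
  have t2 : (A * (P * A⁻¹ * P)).trace = (A⁻¹ * P * A * P).trace := by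
    rw [Matrix.mul_assoc P, ← Matrix.mul_assoc A, trace_mul_comm, ← Matrix.mul_assoc]
  rw [e, e', Matrix.sub_mul, Matrix.mul_sub, mul_nonsing_inv_cancel_left _ _ hu, Matrix.one_mul,
    trace_sub, trace_sub, trace_sub, t1, t2]
  linarith

end Matrix

theorem Real.exp_le_one_add_add_sq {x : ℝ} (hx : x ≤ 1) : Real.exp x ≤ 1 + x + x ^ 2 := by
  rcases le_or_gt (-1) x with h | h
  · have := Real.abs_exp_sub_one_sub_id_le (abs_le.mpr ⟨h, hx⟩)
    linarith [le_abs_self (Real.exp x - 1 - x)]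
  · have : Real.exp x ≤ 1 := Real.exp_le_one_iff.mpr (by linarith)
    nlinarith

theorem Real.mul_exp_div_le {s q : ℝ} (hq : max (s ^ 2) s ≤ q) :
    q * Real.exp (s / q) ≤ q + s + 1 := by
  obtain ⟨h1, h2⟩ := max_le_iff.mp hq
  rcases ((sq_nonneg s).trans h1).eq_or_lt with h0 | h0
  · subst h0
    have : s = 0 := by nlinarith
    simp [this]
  · have h := mul_le_mul_of_nonneg_left
      (Real.exp_le_one_add_add_sq ((div_le_one h0).mpr h2)) h0.le
    have e : q * (1 + s / q + (s / q) ^ 2) = q + s + s ^ 2 / q := by field_simp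
    have : s ^ 2 / q ≤ 1 := (div_le_one h0).mpr h1
    linarith

/-- With `L = B Bᵀ`, `L̂ = B P Bᵀ` (`P` symmetric idempotent),
`ŝ = tr (L - L̂ + L̂ (1 + L̂)⁻¹)`, `s̃ = tr (L̂ (1 + L̂)⁻¹)`, if
`tr (L (1 + L)⁻¹ L - L̂ (1 + L)⁻¹ L̂) ≤ 1` and `q ≥ max {ŝ², ŝ}`, then the acceptance
probability of one iteration of the rejection loop of DPP-VFX satisfies
`e^{q - q e^{ŝ/q} + s̃} det (1 + L) / det (1 + L̂) ≥ e^{-2}`. -/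
theorem acceptance_prob_ge {n r : ℕ} (B : Matrix (Fin n) (Fin r) ℝ)
    (P : Matrix (Fin r) (Fin r) ℝ) (hPsym : Pᵀ = P) (hPidem : P * P = P)
    (L Lhat : Matrix (Fin n) (Fin n) ℝ) (hL : L = B * Bᵀ) (hLhat : Lhat = B * P * Bᵀ)
    (shat stil q : ℝ)
    (hshat : shat = (L - Lhat + Lhat * (1 + Lhat)⁻¹).trace)
    (hstil : stil = (Lhat * (1 + Lhat)⁻¹).trace)
    (hacc : (L * (1 + L)⁻¹ * L - Lhat * (1 + L)⁻¹ * Lhat).trace ≤ 1)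
    (hq : max (shat ^ 2) shat ≤ q) :
    Real.exp (-2) ≤ Real.exp (q - q * Real.exp (shat / q) + stil)
        * (1 + L).det / (1 + Lhat).det := by
  have hA : (1 + L).PosDef := hL ▸ posDef_one_add_self_mul_transpose B
  have hC : (1 + Lhat).PosDef := by
    have h := posDef_one_add_self_mul_transpose (B * P)
    rwa [transpose_mul, hPsym, Matrix.mul_assoc B, ← Matrix.mul_assoc P, hPidem,
      ← Matrix.mul_assoc, ← hLhat] at h
  have hu : IsUnit (1 + L).det := hA.det_pos.ne'.isUnit
  have hcross : 0 ≤ ((L - Lhat) * (1 + L)⁻¹ * Lhat).trace := by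
    rw [hL, hLhat]
    exact trace_nystrom_residual_nonneg B hPsym hPidem
  have hdet := hA.det_le_det_mul_exp_trace hC.posSemidef
  have hexp := Real.mul_exp_div_le hq
  have hLM : L * (1 + L)⁻¹ = 1 - (1 + L)⁻¹ := by
    have h := mul_nonsing_inv _ hu
    rw [Matrix.add_mul, Matrix.one_mul] at h
    exact eq_sub_of_add_eq' h
  have hMC : ((1 + L)⁻¹ * (1 + Lhat)).trace - Fintype.card (Fin n)
      = -((1 + L)⁻¹ * (L - Lhat)).trace := by
    have h : (1 + L)⁻¹ * (1 + Lhat) = 1 - (1 + L)⁻¹ * (L - Lhat) := by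
      rw [eq_sub_iff_add_eq, ← Matrix.mul_add, add_add_sub_cancel, nonsing_inv_mul _ hu]
    rw [h, trace_sub, trace_one]
    ring
  rw [hMC] at hdet
  have hres : (L - Lhat).trace - ((1 + L)⁻¹ * (L - Lhat)).trace ≤ 1 := by
    have h : L * (1 + L)⁻¹ * L - Lhat * (1 + L)⁻¹ * Lhat
        = (L - Lhat) - (1 + L)⁻¹ * (L - Lhat) + (L - Lhat) * (1 + L)⁻¹ * Lhat := by
      simp only [Matrix.sub_mul, Matrix.mul_sub, hLM, Matrix.one_mul]
      abel
    rw [h, trace_add, trace_sub] at hacc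
    linarith
  rw [trace_add, ← hstil] at hshat
  rw [le_div_iff₀ hC.det_pos]
  calc Real.exp (-2) * (1 + Lhat).det
      ≤ Real.exp (-2) * ((1 + L).det * Real.exp (-((1 + L)⁻¹ * (L - Lhat)).trace)) := by gcongr
    _ = Real.exp (-2 - ((1 + L)⁻¹ * (L - Lhat)).trace) * (1 + L).det := by
      rw [sub_eq_add_neg (-2), Real.exp_add]
      ring
    _ ≤ _ := by
      have := hA.det_pos
      gcongr
      linarith
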